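/- Let F₁, F₂ > 0, n ≥ 2 an integer, and q, s ∈ (0,1) satisfy (F₁ + F₂)/F₂ ≥ (n/(2s)) · (1+q)^n / ((1−q²)^s q^n). Then for every R > 0, setting r₀ := qR, the function u(x) := F₂ ∫_{B_R(0)} G_{n,s}(x,y) dy − (F₁ + F₂) ∫_{B_{r₀}(0)} G_{n,s}(x,y) dy satisfies u(x) < 0 for every x ∈ ℝⁿ with |x| < R. -/

import Mathlib

open MeasureTheory

/-- The Green function `G_{n,s}` of the fractional Laplacian on the ball `B_R(0) ⊂ ℝⁿ`. -/
noncomputable def fracGreen (n : ℕ) (s R : ℝ) (x y : EuclideanSpace ℝ (Fin n)) : ℝ :=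
  (Real.Gamma ((n : ℝ) / 2) / (2 ^ (2 * s) * Real.pi ^ (1 / (n : ℝ)) * Real.Gamma s ^ 2)) *
    (∫ w in Set.Ioo (0:ℝ)
        ((R ^ 2 - ‖x‖ ^ 2) * (R ^ 2 - ‖y‖ ^ 2) / (R ^ 2 * ‖x - y‖ ^ 2)),
        w ^ (s - 1) * (1 + w) ^ (-(n : ℝ) / 2)) / ‖x - y‖ ^ ((n : ℝ) - 2 * s)

section GreenFunction

open Set Metric
open scoped ENNReal RealInnerProductSpace

section Polar
variable {E : Type*} [NormedAddCommGroup E] [InnerProductSpace ℝ E] [FiniteDimensional ℝ E]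
  [MeasurableSpace E] [BorelSpace E] [Nontrivial E] (μ : Measure E) [μ.IsAddHaarMeasure]

theorem lintegral_volumeIoiPow (k : ℕ) (f : ℝ → ℝ≥0∞) (hf : Measurable f) :
    ∫⁻ r : Ioi (0:ℝ), f r ∂(Measure.volumeIoiPow k)
      = ∫⁻ r in Ioi (0:ℝ), ENNReal.ofReal (r ^ k) * f r := by
  rw [Measure.volumeIoiPow, lintegral_withDensity_eq_lintegral_mul _ (by fun_prop) (by fun_prop)]
  exact lintegral_subtype_comap measurableSet_Ioi (fun r : ℝ => ENNReal.ofReal (r ^ k) * f r)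

theorem lintegral_eq_lintegral_prod_sphere (f : E → ℝ≥0∞) :
    ∫⁻ y, f y ∂μ = ∫⁻ p, f (p.2.1 • p.1.1)
      ∂(μ.toSphere.prod (Measure.volumeIoiPow (Module.finrank ℝ E - 1))) := by
  have h := μ.measurePreserving_homeomorphUnitSphereProd.lintegral_comp_emb
    (Homeomorph.measurableEmbedding _) (fun p => f (p.2.1 • p.1.1))
  rw [← h]
  have h2 : ∀ y : ({0}ᶜ : Set E), f (((homeomorphUnitSphereProd E) y).2.1 •
      ((homeomorphUnitSphereProd E) y).1.1) = f y := by
    intro y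
    have hy : ‖(y : E)‖ ≠ 0 := norm_ne_zero_iff.2 y.2
    simp [smul_smul, hy]
  simp_rw [h2]
  rw [lintegral_subtype_comap (measurableSet_singleton _).compl f, restrict_compl_singleton]

theorem lintegral_eq_lintegral_sphere_Ioi {f : E → ℝ≥0∞} (hf : Measurable f) :
    ∫⁻ y, f y ∂μ = ∫⁻ θ, ∫⁻ r in Ioi (0:ℝ),
      ENNReal.ofReal (r ^ (Module.finrank ℝ E - 1)) * f (r • θ.1) ∂volume ∂μ.toSphere := by
  rw [lintegral_eq_lintegral_prod_sphere, lintegral_prod _ (by fun_prop)]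
  refine lintegral_congr fun θ => ?_
  exact lintegral_volumeIoiPow _ (fun r => f (r • θ.1)) (by fun_prop)

theorem lintegral_eq_lintegral_Ioi_sphere {f : E → ℝ≥0∞} (hf : Measurable f) :
    ∫⁻ y, f y ∂μ = ∫⁻ r in Ioi (0:ℝ),
      ENNReal.ofReal (r ^ (Module.finrank ℝ E - 1)) * ∫⁻ θ, f (r • θ.1) ∂μ.toSphere := by
  rw [lintegral_eq_lintegral_prod_sphere, lintegral_prod_symm _ (by fun_prop)]
  refine lintegral_volumeIoiPow _ (fun r => ∫⁻ θ : sphere (0:E) 1, f (r • θ.1) ∂μ.toSphere) ?_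
  exact Measurable.lintegral_prod_right (by fun_prop)

theorem lintegral_pow_Ioo {k : ℕ} (hk : k ≠ 0) {ρ : ℝ} (hρ : 0 ≤ ρ) :
    ∫⁻ r in Ioo (0:ℝ) ρ, ENNReal.ofReal (r ^ (k - 1)) = ENNReal.ofReal (ρ ^ k / k) := by
  obtain ⟨m, rfl⟩ := Nat.exists_eq_succ_of_ne_zero hk
  rw [setLIntegral_congr Ioo_ae_eq_Ioc,
    ← ofReal_integral_eq_lintegral_ofReal (intervalIntegral.intervalIntegrable_pow _).1,
    ← intervalIntegral.integral_of_le hρ]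
  · simp
  · filter_upwards [ae_restrict_mem measurableSet_Ioc] with y hy
    exact pow_nonneg hy.1.le _

/-- Pushing the cone with apex `0` over the unit sphere to the cone with apex `a`. -/
theorem lintegral_sphere_sub_le {a : E} (ha : ‖a‖ < 1) {φ : E → ℝ≥0∞} (hφ : Measurable φ)
    (hφ' : ∀ (r : ℝ) (v : E), 0 < r → φ (r • v) = φ v) :
    ENNReal.ofReal (1 / Module.finrank ℝ E) *
      ∫⁻ θ, ENNReal.ofReal (1 - ⟪a, θ.1⟫) * φ (θ.1 - a) ∂μ.toSphere
      ≤ ∫⁻ v in {v | ‖v + a‖ < 1}, φ v ∂μ := by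
  let T : E → E := fun y => y + (1 - ‖y‖) • a
  let T' : E → E →L[ℝ] E := fun y => ContinuousLinearMap.id ℝ E +
    ((-(‖y‖⁻¹ • innerSL ℝ y)) : E →L[ℝ] ℝ).smulRight a
  let S : Set E := ball 0 1 \ {0}
  have hS : MeasurableSet S := measurableSet_ball.diff (measurableSet_singleton _)
  have hT' : ∀ y ∈ S, HasFDerivWithinAt T (T' y) S y := by
    intro y hy
    have hy0 : y ≠ 0 := hy.2
    have h1 : HasFDerivAt (fun y : E => ‖y‖) (‖y‖⁻¹ • innerSL ℝ y) y := by
      have := (hasStrictFDerivAt_norm_sq y).hasFDerivAt.sqrt (by positivity)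
      simp only [Real.sqrt_sq (norm_nonneg _)] at this
      convert this using 1
      ext z
      simp
      field_simp
    have h2 := (hasFDerivAt_id y).add ((h1.const_sub 1).smul_const a)
    exact h2.hasFDerivWithinAt
  have hinj : InjOn T S := by
    intro y _ z _ hyz
    have h1 : y - z = (‖y‖ - ‖z‖) • a := by
      have : y + (1 - ‖y‖) • a = z + (1 - ‖z‖) • a := hyz
      linear_combination (norm := module) this
    have h2 : ‖y - z‖ ≤ ‖y - z‖ * ‖a‖ := by
      calc ‖y - z‖ = |‖y‖ - ‖z‖| * ‖a‖ := by rw [h1, norm_smul, Real.norm_eq_abs]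
        _ ≤ _ := by gcongr; exact abs_norm_sub_norm_le y z
    have h3 : ‖y - z‖ = 0 := by nlinarith [norm_nonneg (y - z)]
    exact sub_eq_zero.1 (norm_eq_zero.1 h3)
  have hdet : ∀ y, (T' y).det = 1 - ⟪a, y⟫ / ‖y‖ := by
    intro y
    have : (T' y : E →ₗ[ℝ] E) =
        LinearMap.transvection ((-(‖y‖⁻¹ • innerSL ℝ y) : E →L[ℝ] ℝ) : E →ₗ[ℝ] ℝ) a := by
      ext z; simp [T', LinearMap.transvection]
    rw [ContinuousLinearMap.det, this, LinearMap.transvection.det]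
    simp [real_inner_comm]
    ring
  have hcov := lintegral_image_eq_lintegral_abs_det_fderiv_mul μ hS hT' hinj (fun z => φ (z - a))
  have hle : ∫⁻ z in T '' S, φ (z - a) ∂μ ≤ ∫⁻ z in ball 0 1, φ (z - a) ∂μ := by
    refine lintegral_mono_set ?_
    rintro _ ⟨y, hy, rfl⟩
    have hy1 : ‖y‖ < 1 := by simpa using hy.1
    rw [mem_ball_zero_iff]
    calc ‖T y‖ ≤ ‖y‖ + ‖(1 - ‖y‖) • a‖ := norm_add_le _ _
      _ = ‖y‖ + (1 - ‖y‖) * ‖a‖ := by rw [norm_smul, Real.norm_of_nonneg (by linarith)]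
      _ < 1 := by nlinarith
  have hshift : ∫⁻ z in ball 0 1, φ (z - a) ∂μ = ∫⁻ v in {v | ‖v + a‖ < 1}, φ v ∂μ := by
    have hm : MeasurableSet {v : E | ‖v + a‖ < 1} := measurableSet_lt (by fun_prop) (by fun_prop)
    rw [← lintegral_indicator measurableSet_ball, ← lintegral_indicator hm,
      ← lintegral_add_right_eq_self _ a]
    refine lintegral_congr fun z => ?_
    simp [indicator]
  rw [← hshift]
  refine le_trans (le_of_eq ?_) hle
  rw [hcov]
  have hpol : ∫⁻ y in S, ENNReal.ofReal |(T' y).det| * φ (T y - a) ∂μ =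
      ∫⁻ y, (ball 0 1).indicator (fun y => ENNReal.ofReal |1 - ⟪a, y⟫ / ‖y‖| *
        φ (y + (1 - ‖y‖) • a - a)) y ∂μ := by
    rw [lintegral_indicator measurableSet_ball, setLIntegral_congr (sdiff_null_ae_eq_self (by simp))]
    simp_rw [hdet, T]
  rw [hpol, lintegral_eq_lintegral_sphere_Ioi μ
    (Measurable.indicator (by fun_prop) measurableSet_ball),
    ← lintegral_const_mul _ (by fun_prop)]
  refine lintegral_congr fun θ => ?_
  have hθ : ‖θ.1‖ = 1 := by simp
  have hin : 0 ≤ 1 - ⟪a, θ.1⟫ := by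
    have := real_inner_le_norm a θ.1
    rw [hθ] at this; linarith
  have : ∀ r ∈ Ioi (0:ℝ), ENNReal.ofReal (r ^ (Module.finrank ℝ E - 1)) *
      (ball 0 1).indicator (fun y => ENNReal.ofReal |1 - ⟪a, y⟫ / ‖y‖| *
        φ (y + (1 - ‖y‖) • a - a)) (r • θ.1) =
      (Ioo 0 1).indicator (fun r => ENNReal.ofReal (r ^ (Module.finrank ℝ E - 1))) r *
        (ENNReal.ofReal (1 - ⟪a, θ.1⟫) * φ (θ.1 - a)) := by
    intro r hr
    have hr : 0 < r := hr
    have hn : ‖r • θ.1‖ = r := by rw [norm_smul, hθ, mul_one, Real.norm_of_nonneg hr.le]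
    have h1 : r • θ.1 + (1 - r) • a - a = r • (θ.1 - a) := by
      rw [sub_smul, smul_sub, one_smul]; abel
    by_cases hr1 : r < 1
    · rw [indicator_of_mem (by simpa [hn] using hr1), indicator_of_mem (show r ∈ Ioo (0:ℝ) 1 from ⟨hr, hr1⟩), hn, h1,
        hφ' _ _ hr, inner_smul_right, mul_div_cancel_left₀ _ hr.ne', abs_of_nonneg hin]
    · rw [indicator_of_notMem (by simpa [hn] using hr1),
        indicator_of_notMem (fun h => hr1 h.2)]; simp
  rw [setLIntegral_congr_fun measurableSet_Ioi this, lintegral_mul_const _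
    (Measurable.indicator (by fun_prop) measurableSet_Ioo), setLIntegral_indicator measurableSet_Ioo,
    inter_eq_left.2 Ioo_subset_Ioi_self, lintegral_pow_Ioo Module.finrank_pos.ne' zero_le_one]
  simp

theorem lintegral_sphere_comp_neg (f : E → ℝ≥0∞) (hf : Measurable f) :
    ∫⁻ θ, f (-θ.1) ∂μ.toSphere = ∫⁻ θ, f θ.1 ∂μ.toSphere := by
  have key : ∀ g : E → ℝ≥0∞, Measurable g →
      ∫⁻ y in ball 0 1, g (‖y‖⁻¹ • y) ∂μ =
        ENNReal.ofReal (1 / Module.finrank ℝ E) * ∫⁻ θ, g θ.1 ∂μ.toSphere := by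
    intro g hg
    rw [← lintegral_indicator measurableSet_ball, lintegral_eq_lintegral_Ioi_sphere μ
      (Measurable.indicator (by fun_prop) measurableSet_ball)]
    have : ∀ r ∈ Ioi (0:ℝ), ENNReal.ofReal (r ^ (Module.finrank ℝ E - 1)) *
        ∫⁻ θ, (ball 0 1).indicator (fun y => g (‖y‖⁻¹ • y)) (r • θ.1) ∂μ.toSphere =
        (Ioo 0 1).indicator (fun r => ENNReal.ofReal (r ^ (Module.finrank ℝ E - 1))) r *
          ∫⁻ θ, g θ.1 ∂μ.toSphere := by
      intro r hr
      have hr : 0 < r := hr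
      have hn : ∀ θ : sphere (0 : E) 1, ‖r • θ.1‖ = r := fun θ => by
        rw [norm_smul, norm_eq_of_mem_sphere, mul_one, Real.norm_of_nonneg hr.le]
      by_cases hr1 : r < 1
      · rw [indicator_of_mem (show r ∈ Ioo (0:ℝ) 1 from ⟨hr, hr1⟩)]
        congr 1
        refine lintegral_congr fun θ => ?_
        rw [indicator_of_mem (by simpa [hn] using hr1), hn, smul_smul, inv_mul_cancel₀ hr.ne',
          one_smul]
      · rw [indicator_of_notMem (fun h => hr1 h.2)]
        have : ∀ θ : sphere (0 : E) 1,
            (ball 0 1).indicator (fun y => g (‖y‖⁻¹ • y)) (r • θ.1) = 0 := fun θ =>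
          indicator_of_notMem (by simpa [hn] using hr1) _
        simp [this]
    rw [setLIntegral_congr_fun measurableSet_Ioi this, lintegral_mul_const _
      (Measurable.indicator (by fun_prop) measurableSet_Ioo), setLIntegral_indicator measurableSet_Ioo,
      inter_eq_left.2 Ioo_subset_Ioi_self, lintegral_pow_Ioo Module.finrank_pos.ne' zero_le_one]
    simp
  have h0 : ENNReal.ofReal (1 / Module.finrank ℝ E) ≠ 0 := by
    have : 0 < Module.finrank ℝ E := Module.finrank_pos
    simpa using this.ne'
  refine (ENNReal.mul_right_inj h0 ENNReal.ofReal_ne_top).1 ?_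
  rw [← key f hf, ← key (fun v => f (-v)) (by fun_prop), ← lintegral_indicator measurableSet_ball,
    ← lintegral_indicator measurableSet_ball, ← lintegral_neg_eq_self]
  refine lintegral_congr fun y => ?_
  simp [indicator]

/-- The Poisson kernel of the unit ball has spherical mean at most `1`. -/
theorem lintegral_sphere_poisson_le {a : E} (ha : ‖a‖ < 1) :
    ∫⁻ θ, ENNReal.ofReal ((1 - ‖a‖ ^ 2) / ‖θ.1 - a‖ ^ Module.finrank ℝ E) ∂μ.toSphere
      ≤ μ.toSphere univ := by
  set d := Module.finrank ℝ E with hd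
  have hdpos : 0 < d := Module.finrank_pos
  have hc : 0 < 1 - ‖a‖ ^ 2 := by nlinarith [norm_nonneg a]
  let N : E → ℝ := fun v => √(⟪v, a⟫ ^ 2 + (1 - ‖a‖ ^ 2) * ‖v‖ ^ 2)
  have hN : ∀ v, v ≠ 0 → |⟪v, a⟫| < N v := fun v hv => by
    rw [← Real.sqrt_sq_eq_abs]
    refine Real.sqrt_lt_sqrt (sq_nonneg _) ?_
    have : 0 < (1 - ‖a‖ ^ 2) * ‖v‖ ^ 2 := by positivity
    linarith
  have hNc : Continuous N := by fun_prop
  have hNs : ∀ (r : ℝ) (v : E), 0 < r → N (r • v) = r * N v := fun r v hr => by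
    have : ⟪r • v, a⟫ ^ 2 + (1 - ‖a‖ ^ 2) * ‖r • v‖ ^ 2 =
        r ^ 2 * (⟪v, a⟫ ^ 2 + (1 - ‖a‖ ^ 2) * ‖v‖ ^ 2) := by
      rw [real_inner_smul_left, norm_smul, Real.norm_of_nonneg hr.le]; ring
    simp only [N]
    rw [this, Real.sqrt_mul (by positivity), Real.sqrt_sq hr.le]
  let φ : E → ℝ≥0∞ := fun v =>
    ENNReal.ofReal (‖v‖ ^ d / (N v - ⟪v, a⟫) ^ d * ((N v + ⟪v, a⟫) / N v))
  have hφ : Measurable φ := by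
    have := hNc.measurable
    fun_prop
  have hφ' : ∀ (r : ℝ) (v : E), 0 < r → φ (r • v) = φ v := fun r v hr => by
    simp only [φ]
    rw [hNs r v hr, real_inner_smul_left, norm_smul, Real.norm_of_nonneg hr.le, ← mul_sub,
      ← mul_add, mul_pow, mul_pow, mul_div_mul_left _ _ hr.ne',
      mul_div_mul_left _ _ (pow_pos hr d).ne']
  let ψ : E → ℝ≥0∞ := fun v => ENNReal.ofReal ((N v + ⟪v, a⟫) / N v)
  have hψ : Measurable ψ := by
    have := hNc.measurable
    fun_prop
  have hle := lintegral_sphere_sub_le μ ha hφ hφ'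
  have hleft : ∀ θ : sphere (0 : E) 1, ENNReal.ofReal (1 - ⟪a, θ.1⟫) * φ (θ.1 - a) =
      ENNReal.ofReal ((1 - ‖a‖ ^ 2) / ‖θ.1 - a‖ ^ d) := fun θ => by
    have hθ : ‖θ.1‖ = 1 := by simp
    have hin : 0 < 1 - ⟪a, θ.1⟫ := by
      have := real_inner_le_norm a θ.1
      rw [hθ] at this; linarith
    have hsq : ‖θ.1 - a‖ ^ 2 = 1 - 2 * ⟪a, θ.1⟫ + ‖a‖ ^ 2 := by
      rw [norm_sub_sq_real, hθ, real_inner_comm]; ring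
    have hi : ⟪θ.1 - a, a⟫ = ⟪a, θ.1⟫ - ‖a‖ ^ 2 := by
      rw [inner_sub_left, real_inner_comm, real_inner_self_eq_norm_sq]
    have hNv : N (θ.1 - a) = 1 - ⟪a, θ.1⟫ := by
      simp only [N]
      rw [hsq, hi, ← Real.sqrt_sq hin.le]
      congr 1; ring
    have hpos : 0 < ‖θ.1 - a‖ := by
      rw [norm_pos_iff, sub_ne_zero]
      rintro h
      rw [← h, hθ] at ha
      exact lt_irrefl _ ha
    simp only [φ]
    rw [← ENNReal.ofReal_mul hin.le, hNv, hi]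
    congr 1
    have e1 : 1 - ⟪a, θ.1⟫ - (⟪a, θ.1⟫ - ‖a‖ ^ 2) = ‖θ.1 - a‖ ^ 2 := by rw [hsq]; ring
    rw [e1]
    field_simp
    ring
  have hright : ∫⁻ v in {v | ‖v + a‖ < 1}, φ v ∂μ =
      ENNReal.ofReal (1 / d) * ∫⁻ θ, ψ θ.1 ∂μ.toSphere := by
    have hm : MeasurableSet {v : E | ‖v + a‖ < 1} := measurableSet_lt (by fun_prop) (by fun_prop)
    rw [← lintegral_indicator hm, lintegral_eq_lintegral_sphere_Ioi μ (hφ.indicator hm),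
      ← lintegral_const_mul _ (by fun_prop)]
    refine lintegral_congr fun θ => ?_
    have hθ : ‖θ.1‖ = 1 := by simp
    have hθ0 : θ.1 ≠ 0 := by rw [← norm_ne_zero_iff, hθ]; exact one_ne_zero
    have hNθ := abs_lt.1 (hN θ.1 hθ0)
    have hNsq : N θ.1 ^ 2 = ⟪θ.1, a⟫ ^ 2 + (1 - ‖a‖ ^ 2) := by
      simp only [N]
      rw [hθ, Real.sq_sqrt (by positivity)]; ring
    have hmem : ∀ r : ℝ, 0 < r → (‖r • θ.1 + a‖ < 1 ↔ r < N θ.1 - ⟪θ.1, a⟫) := fun r hr => by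
      have e : ‖r • θ.1 + a‖ ^ 2 - 1 =
          (r - (N θ.1 - ⟪θ.1, a⟫)) * (r + (N θ.1 + ⟪θ.1, a⟫)) := by
        rw [norm_add_sq_real, norm_smul, hθ, real_inner_smul_left, mul_one,
          Real.norm_of_nonneg hr.le]
        linear_combination hNsq
      have hp : 0 < r + (N θ.1 + ⟪θ.1, a⟫) := by linarith
      rw [← sq_lt_one_iff₀ (norm_nonneg _), ← sub_neg, e, ← sub_neg (a := r)]
      constructor
      · intro h; by_contra hh; push Not at hh; nlinarith
      · intro h; nlinarith
    have : ∀ r ∈ Ioi (0:ℝ), ENNReal.ofReal (r ^ (d - 1)) *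
        {v | ‖v + a‖ < 1}.indicator φ (r • θ.1) =
        (Ioo 0 (N θ.1 - ⟪θ.1, a⟫)).indicator (fun r => ENNReal.ofReal (r ^ (d - 1))) r *
          φ θ.1 := by
      intro r hr
      have hr : 0 < r := hr
      by_cases hr1 : r < N θ.1 - ⟪θ.1, a⟫
      · rw [indicator_of_mem (show r • θ.1 ∈ {v | ‖v + a‖ < 1} from (hmem r hr).2 hr1),
          indicator_of_mem (show r ∈ Ioo 0 (N θ.1 - ⟪θ.1, a⟫) from ⟨hr, hr1⟩), hφ' _ _ hr]
      · rw [indicator_of_notMem (show r • θ.1 ∉ {v | ‖v + a‖ < 1} from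
            fun h => hr1 ((hmem r hr).1 h)),
          indicator_of_notMem (fun h => hr1 h.2)]; simp
    rw [setLIntegral_congr_fun measurableSet_Ioi this, lintegral_mul_const _
      (Measurable.indicator (by fun_prop) measurableSet_Ioo),
      setLIntegral_indicator measurableSet_Ioo,
      inter_eq_left.2 Ioo_subset_Ioi_self, lintegral_pow_Ioo hdpos.ne' (by linarith)]
    simp only [φ, ψ]
    have hp : 0 < N θ.1 - ⟪θ.1, a⟫ := by linarith
    rw [← ENNReal.ofReal_mul (by positivity), ← ENNReal.ofReal_mul (by positivity), hθ]
    congr 1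
    field_simp
    simp
  have hsum : ∫⁻ θ, ψ θ.1 ∂μ.toSphere = μ.toSphere univ := by
    have h2 : 2 * ∫⁻ θ, ψ θ.1 ∂μ.toSphere = 2 * μ.toSphere univ := by
      rw [two_mul]
      nth_rewrite 2 [← lintegral_sphere_comp_neg μ ψ hψ]
      rw [← lintegral_add_left (by fun_prop)]
      have : ∀ θ : sphere (0 : E) 1, ψ θ.1 + ψ (-θ.1) = 2 := fun θ => by
        have hθ0 : θ.1 ≠ 0 := by
          rw [← norm_ne_zero_iff, norm_eq_of_mem_sphere]; exact one_ne_zero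
        have hNθ := hN θ.1 hθ0
        have hpos := (abs_nonneg _).trans_lt hNθ
        have hNθ := abs_lt.1 hNθ
        have hneg : N (-θ.1) = N θ.1 := by simp [N]
        simp only [ψ]
        rw [hneg, inner_neg_left, ← ENNReal.ofReal_add (div_nonneg (by linarith) hpos.le)
          (div_nonneg (by linarith) hpos.le), ← add_div]
        rw [show N θ.1 + ⟪θ.1, a⟫ + (N θ.1 + -⟪θ.1, a⟫) = 2 * N θ.1 by ring,
          mul_div_cancel_right₀ _ hpos.ne']
        simp
      simp [this]
    exact (ENNReal.mul_right_inj two_ne_zero ENNReal.ofNat_ne_top).1 h2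
  rw [hright, hsum] at hle
  simp_rw [hleft] at hle
  have h0 : ENNReal.ofReal (1 / d) ≠ 0 := by simpa using hdpos.ne'
  exact (ENNReal.mul_le_mul_iff_right h0 ENNReal.ofReal_ne_top).1 hle

end Polar

theorem setLIntegral_deriv_eq_sub {g g' : ℝ → ℝ} {a b : ℝ} (hab : a ≤ b)
    (hg : ContinuousOn g (Icc a b)) (hg' : ∀ r ∈ Ioo a b, HasDerivAt g (g' r) r)
    (hpos : ∀ r ∈ Ioo a b, 0 ≤ g' r) :
    ∫⁻ r in Ioo a b, ENNReal.ofReal (g' r) = ENNReal.ofReal (g b - g a) := by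
  have hint : IntegrableOn g' (Ioc a b) := intervalIntegral.integrableOn_deriv_of_nonneg hg hg' hpos
  rw [← intervalIntegral.integral_eq_sub_of_hasDerivAt_of_le hab hg hg'
    ((intervalIntegrable_iff_integrableOn_Ioc_of_le hab).2 hint),
    intervalIntegral.integral_of_le hab, integral_Ioc_eq_integral_Ioo, ofReal_integral_eq_lintegral_ofReal (hint.mono_set Ioo_subset_Ioc_self)]
  filter_upwards [ae_restrict_mem measurableSet_Ioo] with y hy
  exact hpos y hy

theorem ofReal_setIntegral_le_setLIntegral {S : Set ℝ} (hS : MeasurableSet S) {f : ℝ → ℝ}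
    (hf : Measurable f) (hpos : ∀ w ∈ S, 0 ≤ f w) :
    ENNReal.ofReal (∫ w in S, f w) ≤ ∫⁻ w in S, ENNReal.ofReal (f w) := by
  rw [integral_eq_lintegral_of_nonneg_ae _ hf.aestronglyMeasurable]
  · exact ENNReal.ofReal_toReal_le
  · filter_upwards [ae_restrict_mem hS] with y hy
    exact hpos y hy

/-- Writing the radial profile of the Green function as a superposition of Poisson kernels. -/
theorem ofReal_profile_le_lintegral {X Y D P s m : ℝ} (hX : 0 ≤ X) (hXY : 0 < max X Y)
    (hD : 0 < D) (hXP : X < P) (hYP : Y < P) :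
    ENNReal.ofReal ((∫ w in Ioo 0 ((P - X) * (P - Y) / (P * D)),
        w ^ (s - 1) * (1 + w) ^ (-m)) / D ^ (m - s)) ≤
      ∫⁻ ρ in Ioo (max X Y) P, ENNReal.ofReal ((ρ - X) ^ (s - 1) * (ρ - Y) ^ (s - 1) *
        ρ ^ (1 - s) * (1 - X * Y / ρ ^ 2) / (ρ + D - X - Y + X * Y / ρ) ^ m) := by
  set M := max X Y with hM
  have hXM : X ≤ M := le_max_left _ _
  have hYM : Y ≤ M := le_max_right _ _
  have hMP : M < P := max_lt hXP hYP
  let ζ : ℝ → ℝ := fun ρ => (ρ - X) * (ρ - Y) / (ρ * D)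
  let ζ' : ℝ → ℝ := fun ρ => (1 - X * Y / ρ ^ 2) / D
  have hζ' : ∀ ρ, 0 < ρ → HasDerivAt ζ (ζ' ρ) ρ := fun ρ hρ => by
    have h := (((hasDerivAt_id ρ).sub_const X).mul ((hasDerivAt_id ρ).sub_const Y)).div
      ((hasDerivAt_id ρ).mul_const D) (by simp; constructor <;> positivity)
    refine h.congr_deriv ?_
    simp [ζ']
    field_simp
    ring
  have hζ'pos : ∀ ρ, M < ρ → 0 < ζ' ρ := fun ρ hρ => by
    have hρ0 : 0 < ρ := hXY.trans hρ
    refine div_pos (sub_pos.2 ?_) hD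
    rw [div_lt_one (by positivity)]
    nlinarith
  have hcont : ContinuousOn ζ (Icc M P) := fun ρ hρ =>
    (hζ' ρ (hXY.trans_le hρ.1)).continuousAt.continuousWithinAt
  have hmono : StrictMonoOn ζ (Icc M P) := by
    refine strictMonoOn_of_deriv_pos (convex_Icc _ _) hcont fun ρ hρ => ?_
    rw [interior_Icc] at hρ
    rw [(hζ' ρ (hXY.trans hρ.1)).deriv]
    exact hζ'pos ρ hρ.1
  have hζM : ζ M = 0 := by
    rcases max_choice X Y with h | h <;> simp [ζ, hM, h]
  have himage : Ioo 0 (ζ P) ⊆ ζ '' Ioo M P := by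
    rw [← hζM]; exact intermediate_value_Ioo hMP.le hcont
  have hcov := lintegral_image_eq_lintegral_abs_deriv_mul measurableSet_Ioo
    (fun ρ hρ => (hζ' ρ (hXY.trans hρ.1)).hasDerivWithinAt)
    (hmono.injOn.mono (Ioo_subset_Icc_self : Ioo M P ⊆ _))
    (fun w => ENNReal.ofReal (w ^ (s - 1) * (1 + w) ^ (-m)))
  have hDp : 0 < D ^ (m - s) := by positivity
  rw [ENNReal.ofReal_div_of_pos hDp]
  refine ENNReal.div_le_of_le_mul ?_
  calc _ ≤ ∫⁻ w in Ioo 0 (ζ P), ENNReal.ofReal (w ^ (s - 1) * (1 + w) ^ (-m)) := by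
        refine ofReal_setIntegral_le_setLIntegral measurableSet_Ioo (by fun_prop) fun w hw => ?_
        have := hw.1
        positivity
    _ ≤ ∫⁻ w in ζ '' Ioo M P, ENNReal.ofReal (w ^ (s - 1) * (1 + w) ^ (-m)) :=
        lintegral_mono_set himage
    _ = _ := by
        rw [hcov, ← lintegral_mul_const _ (by fun_prop)]
        refine setLIntegral_congr_fun measurableSet_Ioo fun ρ hρ => ?_
        have hρ0 : 0 < ρ := hXY.trans hρ.1
        have h1 : 0 < ρ - X := by linarith [hρ.1]
        have h2 : 0 < ρ - Y := by linarith [hρ.1]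
        have hz := hζ'pos ρ hρ.1
        have hζpos : 0 < ζ ρ := by simp only [ζ]; positivity
        have hQ : ρ + D - X - Y + X * Y / ρ = (1 + ζ ρ) * D := by
          simp only [ζ]; field_simp; ring
        have hn : 0 < 1 - X * Y / ρ ^ 2 := by
          have : 1 - X * Y / ρ ^ 2 = ζ' ρ * D := by simp only [ζ']; field_simp
          rw [this]; positivity
        have hz2 : ζ ρ ^ (s - 1) = (ρ - X) ^ (s - 1) * (ρ - Y) ^ (s - 1) * ρ ^ (1 - s) *
            D ^ (1 - s) := by
          simp only [ζ]
          rw [Real.div_rpow (by positivity) (by positivity), Real.mul_rpow h1.le h2.le,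
            Real.mul_rpow hρ0.le hD.le, div_eq_mul_inv, mul_inv, ← Real.rpow_neg hρ0.le,
            ← Real.rpow_neg hD.le, neg_sub]
          ring
        rw [abs_of_pos hz, ← ENNReal.ofReal_mul hz.le, ← ENNReal.ofReal_mul' hDp.le, hQ,
          Real.mul_rpow (by positivity) hD.le, hz2, Real.rpow_neg (by positivity)]
        congr 1
        have hDD : D ^ (1 - s) = D ^ (m - s) * D / D ^ m := by
          rw [← Real.rpow_add_one hD.ne', ← Real.rpow_sub hD]; congr 1; ring
        rw [hDD]
        simp only [ζ']
        field_simp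

section Layer
variable {E : Type*} [NormedAddCommGroup E]

/-- The density in `ρ` of the Green function of the ball of radius `√ρ`. -/
noncomputable def greenLayer (d : ℕ) (s : ℝ) (x : E) (ρ : ℝ) (y : E) : ℝ :=
  (ρ - ‖x‖ ^ 2) ^ (s - 1) * (ρ - ‖y‖ ^ 2) ^ (s - 1) * ρ ^ (1 - s) *
    (1 - ‖x‖ ^ 2 * ‖y‖ ^ 2 / ρ ^ 2) /
      (ρ + ‖x - y‖ ^ 2 - ‖x‖ ^ 2 - ‖y‖ ^ 2 + ‖x‖ ^ 2 * ‖y‖ ^ 2 / ρ) ^ ((d : ℝ) / 2)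

theorem measurable_greenLayer [MeasurableSpace E] [BorelSpace E] (d : ℕ) (s : ℝ) (x : E) :
    Measurable (fun p : ℝ × E => greenLayer d s x p.1 p.2) := by
  unfold greenLayer
  fun_prop

variable [InnerProductSpace ℝ E]

theorem greenLayer_smul_sphere {d : ℕ} {s : ℝ} {x : E} {ρ r : ℝ} (hρ : 0 < ρ) (hr : 0 < r)
    (θ : sphere (0 : E) 1) :
    greenLayer d s x ρ (r • θ.1) =
      (ρ - ‖x‖ ^ 2) ^ (s - 1) * (ρ - r ^ 2) ^ (s - 1) * ρ ^ (1 - s - d / 2) *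
        ((1 - ‖(r / ρ) • x‖ ^ 2) / ‖θ.1 - (r / ρ) • x‖ ^ d) := by
  have hθ : ‖θ.1‖ = 1 := by simp
  have hn : ‖r • θ.1‖ = r := by rw [norm_smul, hθ, mul_one, Real.norm_of_nonneg hr.le]
  have ha : ‖(r / ρ) • x‖ = r / ρ * ‖x‖ := by
    rw [norm_smul, Real.norm_of_nonneg (by positivity)]
  have hQ : ρ + ‖x - r • θ.1‖ ^ 2 - ‖x‖ ^ 2 - r ^ 2 + ‖x‖ ^ 2 * r ^ 2 / ρ =
      ρ * ‖θ.1 - (r / ρ) • x‖ ^ 2 := by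
    rw [norm_sub_sq_real, norm_sub_sq_real, ha, hn, hθ, real_inner_smul_right,
      real_inner_smul_right, real_inner_comm]
    field_simp
    ring
  have hpow : (‖θ.1 - (r / ρ) • x‖ ^ 2) ^ ((d : ℝ) / 2) = ‖θ.1 - (r / ρ) • x‖ ^ d := by
    rw [← Real.rpow_natCast, ← Real.rpow_natCast, ← Real.rpow_mul (norm_nonneg _)]
    congr 1; push_cast; ring
  rw [greenLayer, hn, hQ, Real.mul_rpow hρ.le (by positivity), hpow, ha, Real.rpow_sub hρ (1 - s)]
  have : (r / ρ * ‖x‖) ^ 2 = ‖x‖ ^ 2 * r ^ 2 / ρ ^ 2 := by field_simp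
  rw [this]
  simp only [div_eq_mul_inv, mul_inv]
  ring

variable [FiniteDimensional ℝ E] [MeasurableSpace E] [BorelSpace E] [Nontrivial E] (μ : Measure E)
  [μ.IsAddHaarMeasure]

theorem lintegral_greenLayer_le {s : ℝ} (hs : 0 < s) (hd : 2 ≤ Module.finrank ℝ E) {x : E} {ρ : ℝ}
    (hxρ : ‖x‖ ^ 2 < ρ) :
    ∫⁻ y in {y | ‖y‖ ^ 2 < ρ}, ENNReal.ofReal (greenLayer (Module.finrank ℝ E) s x ρ y) ∂μ ≤
      ENNReal.ofReal ((ρ - ‖x‖ ^ 2) ^ (s - 1) / (2 * s)) * μ.toSphere univ := by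
  set d := Module.finrank ℝ E with hdd
  have hρ : 0 < ρ := (sq_nonneg _).trans_lt hxρ
  have hX : 0 < ρ - ‖x‖ ^ 2 := sub_pos.2 hxρ
  have hm : MeasurableSet {y : E | ‖y‖ ^ 2 < ρ} := measurableSet_lt (by fun_prop) (by fun_prop)
  have hmeas : Measurable (fun y => ENNReal.ofReal (greenLayer d s x ρ y)) :=
    ((measurable_greenLayer d s x).comp (by fun_prop : Measurable fun y : E => (ρ, y))).ennreal_ofReal
  rw [← lintegral_indicator hm, lintegral_eq_lintegral_Ioi_sphere μ (hmeas.indicator hm)]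
  have hpt : ∀ r ∈ Ioi (0:ℝ), ENNReal.ofReal (r ^ (d - 1)) *
      ∫⁻ θ, {y | ‖y‖ ^ 2 < ρ}.indicator (fun y => ENNReal.ofReal (greenLayer d s x ρ y)) (r • θ.1)
        ∂μ.toSphere ≤
      (Ioo 0 (√ρ)).indicator (fun r => ENNReal.ofReal (r * (ρ - r ^ 2) ^ (s - 1))) r *
        (ENNReal.ofReal ((ρ - ‖x‖ ^ 2) ^ (s - 1) * ρ ^ (-s)) * μ.toSphere univ) := by
    intro r hr
    have hr : 0 < r := hr
    have hn : ∀ θ : sphere (0 : E) 1, ‖r • θ.1‖ = r := fun θ => by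
      rw [norm_smul, norm_eq_of_mem_sphere, mul_one, Real.norm_of_nonneg hr.le]
    by_cases hr1 : r < √ρ
    · have hrρ : r ^ 2 < ρ := (Real.lt_sqrt hr.le).1 hr1
      have hY : 0 < ρ - r ^ 2 := sub_pos.2 hrρ
      have ha : ‖(r / ρ) • x‖ < 1 := by
        rw [norm_smul, Real.norm_of_nonneg (by positivity), div_mul_eq_mul_div, div_lt_one hρ]
        refine lt_of_pow_lt_pow_left₀ 2 hρ.le ?_
        rw [mul_pow]
        nlinarith [sq_nonneg r, sq_nonneg ‖x‖]
      have hind : ∀ θ : sphere (0 : E) 1, {y | ‖y‖ ^ 2 < ρ}.indicator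
          (fun y => ENNReal.ofReal (greenLayer d s x ρ y)) (r • θ.1) =
          ENNReal.ofReal ((ρ - ‖x‖ ^ 2) ^ (s - 1) * (ρ - r ^ 2) ^ (s - 1) * ρ ^ (1 - s - d / 2)) *
            ENNReal.ofReal ((1 - ‖(r / ρ) • x‖ ^ 2) / ‖θ.1 - (r / ρ) • x‖ ^ d) := fun θ => by
        rw [indicator_of_mem (by simpa [hn] using hrρ), greenLayer_smul_sphere hρ hr,
          ENNReal.ofReal_mul (by positivity)]
      simp_rw [hind]
      rw [lintegral_const_mul _ (by fun_prop),
        indicator_of_mem (show r ∈ Ioo 0 (√ρ) from ⟨hr, hr1⟩), ← mul_assoc, ← mul_assoc,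
        ← ENNReal.ofReal_mul (by positivity), ← ENNReal.ofReal_mul (by positivity)]
      refine mul_le_mul' (ENNReal.ofReal_le_ofReal ?_) (lintegral_sphere_poisson_le μ ha)
      have hrd : r ^ (d - 1) ≤ r * ρ ^ ((d : ℝ) / 2 - 1) := by
        obtain ⟨k, hk⟩ := Nat.exists_eq_add_of_le hd
        have h1 : r ^ (d - 1) = r * r ^ k := by
          rw [hk, show 2 + k - 1 = k + 1 by omega, pow_succ']
        have h2 : ρ ^ ((d : ℝ) / 2 - 1) = (√ρ) ^ k := by
          rw [Real.sqrt_eq_rpow, ← Real.rpow_natCast, ← Real.rpow_mul hρ.le, hk]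
          congr 1; push_cast; ring
        rw [h1, h2]
        gcongr
      have hexp : ρ ^ ((d : ℝ) / 2 - 1) * ρ ^ (1 - s - (d : ℝ) / 2) = ρ ^ (-s) := by
        rw [← Real.rpow_add hρ]; congr 1; ring
      calc _ ≤ r * ρ ^ ((d : ℝ) / 2 - 1) *
            ((ρ - ‖x‖ ^ 2) ^ (s - 1) * (ρ - r ^ 2) ^ (s - 1) * ρ ^ (1 - s - (d : ℝ) / 2)) := by
            gcongr
        _ = _ := by rw [← hexp]; ring
    · rw [indicator_of_notMem (fun h => hr1 h.2)]
      have : ∀ θ : sphere (0 : E) 1, {y | ‖y‖ ^ 2 < ρ}.indicator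
          (fun y => ENNReal.ofReal (greenLayer d s x ρ y)) (r • θ.1) = 0 := fun θ =>
        indicator_of_notMem (by simpa [hn, Real.lt_sqrt hr.le] using hr1) _
      simp [this]
  refine (setLIntegral_mono' measurableSet_Ioi hpt).trans (le_of_eq ?_)
  have hprim : ∫⁻ r in Ioo 0 (√ρ), ENNReal.ofReal (r * (ρ - r ^ 2) ^ (s - 1)) =
      ENNReal.ofReal (ρ ^ s / (2 * s)) := by
    have hpos : ∀ r ∈ Ioo 0 (√ρ), 0 < ρ - r ^ 2 := fun r hr =>
      sub_pos.2 ((Real.lt_sqrt hr.1.le).1 hr.2)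
    rw [setLIntegral_deriv_eq_sub (g := fun r => -((ρ - r ^ 2) ^ s / (2 * s))) (Real.sqrt_nonneg _)]
    · simp [Real.sq_sqrt hρ.le, Real.zero_rpow hs.ne']
    · exact ((ContinuousOn.rpow_const (by fun_prop) fun _ _ => Or.inr hs.le).div_const _).neg
    · intro r hr
      have h := (((((hasDerivAt_id r).pow 2).const_sub ρ).rpow_const (p := s)
        (Or.inl (hpos r hr).ne')).div_const (2 * s)).neg
      refine h.congr_deriv ?_
      simp
      field_simp
    · intro r hr
      exact mul_nonneg hr.1.le (Real.rpow_nonneg (hpos r hr).le _)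
  rw [lintegral_mul_const _ (Measurable.indicator (by fun_prop) measurableSet_Ioo),
    setLIntegral_indicator measurableSet_Ioo, inter_eq_left.2 Ioo_subset_Ioi_self, hprim,
    ← mul_assoc, ← ENNReal.ofReal_mul (by positivity)]
  congr 2
  rw [Real.rpow_neg hρ.le]
  have := Real.rpow_pos_of_pos hρ s
  field_simp

theorem lintegral_green_profile_le {s : ℝ} (hs : 0 < s) (hd : 2 ≤ Module.finrank ℝ E) {x : E}
    {R : ℝ} (hx : ‖x‖ < R) :
    ∫⁻ y in ball 0 R, ENNReal.ofReal ((∫ w in Ioo 0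
        ((R ^ 2 - ‖x‖ ^ 2) * (R ^ 2 - ‖y‖ ^ 2) / (R ^ 2 * ‖x - y‖ ^ 2)),
        w ^ (s - 1) * (1 + w) ^ (-(Module.finrank ℝ E : ℝ) / 2)) /
          ‖x - y‖ ^ ((Module.finrank ℝ E : ℝ) - 2 * s)) ∂μ ≤
      ENNReal.ofReal ((R ^ 2 - ‖x‖ ^ 2) ^ s / (2 * s ^ 2)) * μ.toSphere univ := by
  set d := Module.finrank ℝ E with hdd
  have hR : 0 < R := (norm_nonneg _).trans_lt hx
  have hxR : ‖x‖ ^ 2 < R ^ 2 := by gcongr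
  have hm : MeasurableSet {p : ℝ × E | ‖p.2‖ ^ 2 < p.1} :=
    measurableSet_lt (by fun_prop) (by fun_prop)
  let H : ℝ × E → ℝ≥0∞ := {p : ℝ × E | ‖p.2‖ ^ 2 < p.1}.indicator
    fun p => ENNReal.ofReal (greenLayer d s x p.1 p.2)
  have hH : Measurable H := (measurable_greenLayer d s x).ennreal_ofReal.indicator hm
  have hpt : ∀ᵐ y ∂μ.restrict (ball 0 R), ENNReal.ofReal ((∫ w in Ioo 0
        ((R ^ 2 - ‖x‖ ^ 2) * (R ^ 2 - ‖y‖ ^ 2) / (R ^ 2 * ‖x - y‖ ^ 2)),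
        w ^ (s - 1) * (1 + w) ^ (-(d : ℝ) / 2)) / ‖x - y‖ ^ ((d : ℝ) - 2 * s)) ≤
      ∫⁻ ρ in Ioo (‖x‖ ^ 2) (R ^ 2), H (ρ, y) := by
    have hne : ∀ᵐ y ∂μ.restrict (ball 0 R), y ≠ x := by
      refine ae_restrict_of_ae ?_
      simp [ae_iff]
    filter_upwards [hne, ae_restrict_mem measurableSet_ball] with y hyx hy
    have hyR : ‖y‖ ^ 2 < R ^ 2 := by
      have : ‖y‖ < R := by simpa using hy
      gcongr
    have hD : 0 < ‖x - y‖ := norm_pos_iff.2 (sub_ne_zero.2 hyx.symm)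
    have hmax : 0 < max (‖x‖ ^ 2) (‖y‖ ^ 2) := by
      rw [lt_max_iff]
      by_contra! h
      have h1 : x = 0 := by simpa using le_antisymm h.1 (sq_nonneg _)
      have h2 : y = 0 := by simpa using le_antisymm h.2 (sq_nonneg _)
      exact hyx (h2.trans h1.symm)
    have h := ofReal_profile_le_lintegral (s := s) (m := (d : ℝ) / 2) (sq_nonneg ‖x‖)
      hmax (pow_pos hD 2) hxR hyR
    have hpow : (‖x - y‖ ^ 2) ^ ((d : ℝ) / 2 - s) = ‖x - y‖ ^ ((d : ℝ) - 2 * s) := by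
      rw [← Real.rpow_natCast, ← Real.rpow_mul hD.le]; congr 1; push_cast; ring
    rw [hpow, ← neg_div] at h
    refine h.trans ?_
    have hsub : Ioo (max (‖x‖ ^ 2) (‖y‖ ^ 2)) (R ^ 2) ⊆ Ioo (‖x‖ ^ 2) (R ^ 2) :=
      Ioo_subset_Ioo_left (le_max_left _ _)
    refine le_trans (le_of_eq ?_) (lintegral_mono_set hsub)
    refine setLIntegral_congr_fun measurableSet_Ioo fun ρ hρ => ?_
    have hmem : (ρ, y) ∈ {p : ℝ × E | ‖p.2‖ ^ 2 < p.1} := (le_max_right _ _).trans_lt hρ.1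
    simp only [H]
    rw [indicator_of_mem hmem]
    rfl
  calc _ ≤ ∫⁻ y in ball 0 R, ∫⁻ ρ in Ioo (‖x‖ ^ 2) (R ^ 2), H (ρ, y) ∂volume ∂μ :=
        lintegral_mono_ae hpt
    _ ≤ ∫⁻ y, ∫⁻ ρ in Ioo (‖x‖ ^ 2) (R ^ 2), H (ρ, y) ∂volume ∂μ :=
        lintegral_mono' Measure.restrict_le_self le_rfl
    _ = ∫⁻ ρ in Ioo (‖x‖ ^ 2) (R ^ 2), ∫⁻ y, H (ρ, y) ∂μ :=
        lintegral_lintegral_swap (by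
          refine Measurable.aemeasurable ?_
          exact hH.comp measurable_swap)
    _ ≤ ∫⁻ ρ in Ioo (‖x‖ ^ 2) (R ^ 2),
          ENNReal.ofReal ((ρ - ‖x‖ ^ 2) ^ (s - 1) / (2 * s)) * μ.toSphere univ := by
        refine setLIntegral_mono' measurableSet_Ioo fun ρ hρ => ?_
        refine le_trans (le_of_eq ?_) (lintegral_greenLayer_le μ hs hd hρ.1)
        rw [← lintegral_indicator (measurableSet_lt (by fun_prop) (by fun_prop))]
        rfl
    _ = _ := by
        rw [lintegral_mul_const _ (by fun_prop)]
        congr 1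
        rw [setLIntegral_deriv_eq_sub (g := fun ρ => (ρ - ‖x‖ ^ 2) ^ s / (2 * s ^ 2)) hxR.le]
        · simp [Real.zero_rpow hs.ne']
        · exact (ContinuousOn.rpow_const (by fun_prop) fun _ _ => Or.inr hs.le).div_const _
        · intro ρ hρ
          have h := (((hasDerivAt_id ρ).sub_const (‖x‖ ^ 2)).rpow_const (p := s)
            (Or.inl (sub_pos.2 hρ.1).ne')).div_const (2 * s ^ 2)
          refine h.congr_deriv ?_
          simp
          field_simp
        · intro ρ hρ
          have := Real.rpow_nonneg (sub_pos.2 hρ.1).le (s - 1)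
          positivity

end Layer

theorem integrableOn_rpow_mul_one_add_rpow {s m ζ : ℝ} (hs : 0 < s) (hm : 0 ≤ m) :
    IntegrableOn (fun w : ℝ => w ^ (s - 1) * (1 + w) ^ (-m)) (Ioo 0 ζ) := by
  have h1 : IntegrableOn (fun w : ℝ => w ^ (s - 1)) (Ioo 0 ζ) := by
    rcases le_or_gt ζ 0 with h | h
    · simp [Ioo_eq_empty (not_lt.2 h)]
    · exact (intervalIntegral.integrableOn_Ioo_rpow_iff h).2 (by linarith)
  refine Integrable.mono' h1 (by fun_prop) ?_
  filter_upwards [ae_restrict_mem measurableSet_Ioo] with w hw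
  have hw0 : 0 < w := hw.1
  rw [Real.norm_of_nonneg (by positivity)]
  exact mul_le_of_le_one_right (by positivity)
    (Real.rpow_le_one_of_one_le_of_nonpos (by linarith) (by linarith))

theorem rpow_div_mul_le_setIntegral {s m ζ : ℝ} (hs : 0 < s) (hm : 0 ≤ m) (hζ : 0 < ζ) :
    ζ ^ s / s * (1 + ζ) ^ (-m) ≤ ∫ w in Ioo 0 ζ, w ^ (s - 1) * (1 + w) ^ (-m) := by
  have h1 : IntegrableOn (fun w : ℝ => w ^ (s - 1)) (Ioo 0 ζ) :=
    (intervalIntegral.integrableOn_Ioo_rpow_iff hζ).2 (by linarith)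
  have h2 : ∫ w in Ioo 0 ζ, w ^ (s - 1) * (1 + ζ) ^ (-m) = ζ ^ s / s * (1 + ζ) ^ (-m) := by
    rw [integral_mul_const, ← integral_Ioc_eq_integral_Ioo,
      ← intervalIntegral.integral_of_le hζ.le, integral_rpow (Or.inl (by linarith))]
    simp [Real.zero_rpow hs.ne']
  rw [← h2]
  refine setIntegral_mono_on (h1.mul_const _) (integrableOn_rpow_mul_one_add_rpow hs hm)
    measurableSet_Ioo fun w hw => ?_
  have hw0 : 0 < w := hw.1
  gcongr ?_ * ?_
  exact Real.rpow_le_rpow_of_nonpos (by linarith) (by linarith [hw.2]) (by linarith)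

theorem measurable_setIntegral_Ioo {s m : ℝ} (hs : 0 < s) (hm : 0 ≤ m) :
    Measurable (fun ζ : ℝ => ∫ w in Ioo 0 ζ, w ^ (s - 1) * (1 + w) ^ (-m)) := by
  refine Monotone.measurable fun a b hab => ?_
  refine setIntegral_mono_set (integrableOn_rpow_mul_one_add_rpow hs hm) ?_
    (Filter.Eventually.of_forall (Ioo_subset_Ioo_right hab))
  filter_upwards [ae_restrict_mem measurableSet_Ioo] with w hw
  have hw0 : 0 < w := hw.1
  simp only [Pi.zero_apply]
  positivity

/-- The Green function of the ball without its normalizing constant. -/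
noncomputable def greenProfile (n : ℕ) (s R : ℝ) (x y : EuclideanSpace ℝ (Fin n)) : ℝ :=
  (∫ w in Ioo (0:ℝ) ((R ^ 2 - ‖x‖ ^ 2) * (R ^ 2 - ‖y‖ ^ 2) / (R ^ 2 * ‖x - y‖ ^ 2)),
    w ^ (s - 1) * (1 + w) ^ (-(n : ℝ) / 2)) / ‖x - y‖ ^ ((n : ℝ) - 2 * s)

theorem greenProfile_nonneg (n : ℕ) (s R : ℝ) (x y : EuclideanSpace ℝ (Fin n)) :
    0 ≤ greenProfile n s R x y := by
  refine div_nonneg (setIntegral_nonneg measurableSet_Ioo fun w hw => ?_) (by positivity)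
  have hw0 : 0 < w := hw.1
  positivity

theorem measurable_greenProfile (n : ℕ) {s : ℝ} (hs : 0 < s) (R : ℝ)
    (x : EuclideanSpace ℝ (Fin n)) : Measurable (greenProfile n s R x) := by
  have h := measurable_setIntegral_Ioo (m := (n : ℝ) / 2) hs (by positivity)
  simp_rw [← neg_div] at h
  unfold greenProfile
  exact (h.comp (by fun_prop)).div (by fun_prop)

theorem lt_greenProfile {n : ℕ} {s R q : ℝ} (hs : 0 < s) (hq : 0 < q) (hq1 : q < 1)
    {x y : EuclideanSpace ℝ (Fin n)} (hx : ‖x‖ < R) (hy : ‖y‖ < q * R) (hxy : x ≠ y) :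
    (R ^ 2 - ‖x‖ ^ 2) ^ s * (1 - q ^ 2) ^ s / (s * ((1 + q) * R) ^ n) <
      greenProfile n s R x y := by
  have hR : 0 < R := (norm_nonneg _).trans_lt hx
  have hX : 0 < R ^ 2 - ‖x‖ ^ 2 := by rw [sub_pos]; gcongr
  have hq2 : 0 < 1 - q ^ 2 := by nlinarith
  have hYq : R ^ 2 * (1 - q ^ 2) < R ^ 2 - ‖y‖ ^ 2 := by
    have : ‖y‖ ^ 2 < (q * R) ^ 2 := by gcongr
    nlinarith
  have hY : 0 < R ^ 2 - ‖y‖ ^ 2 := lt_trans (by positivity) hYq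
  have hD : 0 < ‖x - y‖ := norm_pos_iff.2 (sub_ne_zero.2 hxy)
  set ζ := (R ^ 2 - ‖x‖ ^ 2) * (R ^ 2 - ‖y‖ ^ 2) / (R ^ 2 * ‖x - y‖ ^ 2) with hζdef
  have hζ : 0 < ζ := by positivity
  have hζD : ζ * ‖x - y‖ ^ 2 = (R ^ 2 - ‖x‖ ^ 2) * ((R ^ 2 - ‖y‖ ^ 2) / R ^ 2) := by
    rw [hζdef]; field_simp
  have hQ : (1 + ζ) * ‖x - y‖ ^ 2 ≤ ((1 + q) * R) ^ 2 := by
    have hi : -(‖x‖ * ‖y‖) ≤ inner ℝ x y := neg_le_of_abs_le (abs_real_inner_le_norm x y)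
    have h1 : (1 + ζ) * ‖x - y‖ ^ 2 ≤ (R + ‖x‖ * ‖y‖ / R) ^ 2 := by
      rw [one_add_mul, hζD, norm_sub_sq_real]
      have : (R ^ 2 - ‖x‖ ^ 2) * ((R ^ 2 - ‖y‖ ^ 2) / R ^ 2) =
          R ^ 2 - ‖x‖ ^ 2 - ‖y‖ ^ 2 + (‖x‖ * ‖y‖ / R) ^ 2 := by field_simp; ring
      rw [this, add_sq, show 2 * R * (‖x‖ * ‖y‖ / R) = 2 * (‖x‖ * ‖y‖) by field_simp]
      linarith
    refine h1.trans ?_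
    have h2 : ‖x‖ * ‖y‖ / R ≤ q * R := by
      rw [div_le_iff₀ hR]
      calc ‖x‖ * ‖y‖ ≤ R * (q * R) := by gcongr
        _ = _ := by ring
    have : R + ‖x‖ * ‖y‖ / R ≤ (1 + q) * R := by linarith
    gcongr
  have hpow : ∀ {b : ℝ}, 0 ≤ b → (b ^ 2) ^ ((n : ℝ) / 2) = b ^ n := fun {b} hb => by
    rw [← Real.rpow_natCast, ← Real.rpow_natCast, ← Real.rpow_mul hb]
    congr 1; push_cast; ring
  have hQn : ((1 + ζ) * ‖x - y‖ ^ 2) ^ ((n : ℝ) / 2) ≤ ((1 + q) * R) ^ n := by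
    rw [← hpow (by positivity : 0 ≤ (1 + q) * R)]
    exact Real.rpow_le_rpow (by positivity) hQ (by positivity)
  have hζs : (R ^ 2 - ‖x‖ ^ 2) ^ s * (1 - q ^ 2) ^ s < (ζ * ‖x - y‖ ^ 2) ^ s := by
    rw [hζD, ← Real.mul_rpow hX.le hq2.le]
    refine Real.rpow_lt_rpow (by positivity) ?_ hs
    refine mul_lt_mul_of_pos_left ?_ hX
    rw [lt_div_iff₀ (by positivity)]
    linarith
  have hint := rpow_div_mul_le_setIntegral (m := (n : ℝ) / 2) hs (by positivity) hζ
  rw [← neg_div] at hint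
  calc _ < (ζ * ‖x - y‖ ^ 2) ^ s / (s * ((1 + q) * R) ^ n) := by gcongr
    _ ≤ (ζ * ‖x - y‖ ^ 2) ^ s / (s * ((1 + ζ) * ‖x - y‖ ^ 2) ^ ((n : ℝ) / 2)) := by gcongr
    _ = (ζ ^ s / s * (1 + ζ) ^ (-(n : ℝ) / 2)) / ‖x - y‖ ^ ((n : ℝ) - 2 * s) := by
      have hDs : (‖x - y‖ ^ 2) ^ s = ‖x - y‖ ^ (2 * s) := by
        rw [← Real.rpow_natCast, ← Real.rpow_mul hD.le]; norm_num
      rw [Real.mul_rpow hζ.le (by positivity), Real.mul_rpow (by positivity) (by positivity),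
        hpow hD.le, hDs, Real.rpow_sub hD, Real.rpow_natCast, neg_div,
        Real.rpow_neg (by positivity)]
      field_simp
    _ ≤ _ := by unfold greenProfile; gcongr

section Main
variable {n : ℕ} {s R : ℝ} {x : EuclideanSpace ℝ (Fin n)}

theorem lintegral_greenProfile_le (hn : 2 ≤ n) (hs : 0 < s) (hx : ‖x‖ < R) :
    ∫⁻ y in ball 0 R, ENNReal.ofReal (greenProfile n s R x y) ≤
      ENNReal.ofReal ((R ^ 2 - ‖x‖ ^ 2) ^ s / (2 * s ^ 2) *
        (n * volume.real (ball (0 : EuclideanSpace ℝ (Fin n)) 1))) := by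
  have : Nonempty (Fin n) := ⟨⟨0, by omega⟩⟩
  have hfin : Module.finrank ℝ (EuclideanSpace ℝ (Fin n)) = n := by simp
  have hX : 0 ≤ R ^ 2 - ‖x‖ ^ 2 := by rw [sub_nonneg]; gcongr
  have h := lintegral_green_profile_le volume hs (hfin.symm ▸ hn) hx
  rw [← ofReal_measureReal (measure_ne_top _ _), ← ENNReal.ofReal_mul (by positivity),
    Measure.toSphere_real_apply_univ, hfin] at h
  exact h

theorem integrableOn_greenProfile (hn : 2 ≤ n) (hs : 0 < s) (hx : ‖x‖ < R) :
    IntegrableOn (greenProfile n s R x) (ball 0 R) := by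
  refine ⟨(measurable_greenProfile n hs R x).aestronglyMeasurable, ?_⟩
  rw [hasFiniteIntegral_iff_ofReal (.of_forall fun y => greenProfile_nonneg n s R x y)]
  exact (lintegral_greenProfile_le hn hs hx).trans_lt ENNReal.ofReal_lt_top

theorem setIntegral_greenProfile_le (hn : 2 ≤ n) (hs : 0 < s) (hx : ‖x‖ < R) :
    ∫ y in ball 0 R, greenProfile n s R x y ≤
      (R ^ 2 - ‖x‖ ^ 2) ^ s / (2 * s ^ 2) *
        (n * volume.real (ball (0 : EuclideanSpace ℝ (Fin n)) 1)) := by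
  have hX : 0 ≤ R ^ 2 - ‖x‖ ^ 2 := by rw [sub_nonneg]; gcongr
  rw [integral_eq_lintegral_of_nonneg_ae (.of_forall fun y => greenProfile_nonneg n s R x y)
    (measurable_greenProfile n hs R x).aestronglyMeasurable]
  exact ENNReal.toReal_le_of_le_ofReal (by positivity) (lintegral_greenProfile_le hn hs hx)

theorem lt_setIntegral_greenProfile (hn : 2 ≤ n) (hs : 0 < s) {q : ℝ} (hq : 0 < q) (hq1 : q < 1)
    (hx : ‖x‖ < R) :
    (R ^ 2 - ‖x‖ ^ 2) ^ s * (1 - q ^ 2) ^ s * q ^ n / (s * (1 + q) ^ n) *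
      volume.real (ball (0 : EuclideanSpace ℝ (Fin n)) 1) <
      ∫ y in ball 0 (q * R), greenProfile n s R x y := by
  have : Nonempty (Fin n) := ⟨⟨0, by omega⟩⟩
  have hR : 0 < R := (norm_nonneg _).trans_lt hx
  set c := (R ^ 2 - ‖x‖ ^ 2) ^ s * (1 - q ^ 2) ^ s / (s * ((1 + q) * R) ^ n) with hc
  have hvol : volume.real (ball (0 : EuclideanSpace ℝ (Fin n)) (q * R)) =
      (q * R) ^ n * volume.real (ball (0 : EuclideanSpace ℝ (Fin n)) 1) := by
    simp [measureReal_def, Measure.addHaar_ball_of_pos volume _ (mul_pos hq hR),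
      ENNReal.toReal_ofReal (by positivity : 0 ≤ (q * R) ^ n)]
  have hconst : ∫ _ in ball (0 : EuclideanSpace ℝ (Fin n)) (q * R), c =
      (R ^ 2 - ‖x‖ ^ 2) ^ s * (1 - q ^ 2) ^ s * q ^ n / (s * (1 + q) ^ n) *
      volume.real (ball (0 : EuclideanSpace ℝ (Fin n)) 1) := by
    rw [setIntegral_const, hvol, hc, smul_eq_mul, mul_pow, mul_pow]
    field_simp
  have hint : IntegrableOn (greenProfile n s R x) (ball 0 (q * R)) :=
    (integrableOn_greenProfile hn hs hx).mono_set (ball_subset_ball (by nlinarith))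
  have hci : IntegrableOn (fun _ => c) (ball (0 : EuclideanSpace ℝ (Fin n)) (q * R)) :=
    integrableOn_const measure_ball_lt_top.ne
  have hlt : ∀ᵐ y ∂volume.restrict (ball (0 : EuclideanSpace ℝ (Fin n)) (q * R)),
      c < greenProfile n s R x y := by
    have hne : ∀ᵐ y ∂volume.restrict (ball (0 : EuclideanSpace ℝ (Fin n)) (q * R)), y ≠ x := by
      refine ae_restrict_of_ae ?_
      simp [ae_iff]
    filter_upwards [hne, ae_restrict_mem measurableSet_ball] with y hyx hy
    exact lt_greenProfile hs hq hq1 hx (by simpa using hy) hyx.symm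
  rw [← hconst, ← sub_pos, ← integral_sub hint hci, integral_pos_iff_support_of_nonneg_ae
    (hlt.mono fun y hy => (sub_pos.2 hy).le) (hint.sub hci), pos_iff_ne_zero]
  intro h0
  have hfalse : ∀ᵐ y ∂volume.restrict (ball (0 : EuclideanSpace ℝ (Fin n)) (q * R)), False := by
    have h0' : ∀ᵐ y ∂volume.restrict (ball (0 : EuclideanSpace ℝ (Fin n)) (q * R)),
        y ∉ Function.support fun y => greenProfile n s R x y - c := measure_eq_zero_iff_ae_notMem.1 h0
    filter_upwards [hlt, h0'] with y h1 h2
    exact h2 (sub_pos.2 h1).ne'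
  rw [Filter.eventually_false_iff_eq_bot, ae_eq_bot, Measure.restrict_eq_zero] at hfalse
  exact (measure_ball_pos volume 0 (mul_pos hq hR)).ne' hfalse

end Main

end GreenFunction

/-- Let `F₁, F₂ > 0`, `n ≥ 2`, `q, s ∈ (0,1)` with
`(F₁ + F₂)/F₂ ≥ (n/(2s)) (1+q)^n / ((1−q²)^s q^n)`. Then for every `R > 0`, with
`r₀ := qR`, the Green-function representative
`u(x) = F₂ ∫_{B_R} G(x,y) dy − (F₁+F₂) ∫_{B_{r₀}} G(x,y) dy` of the local Dirichlet
problem satisfies `u(x) < 0` for every `x` with `|x| < R`. -/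
theorem local_solution_negative (n : ℕ) (hn : 2 ≤ n) (s q F₁ F₂ : ℝ)
    (hs : s ∈ Set.Ioo (0:ℝ) 1) (hq : q ∈ Set.Ioo (0:ℝ) 1)
    (hF₁ : 0 < F₁) (hF₂ : 0 < F₂)
    (hF : (F₁ + F₂) / F₂ ≥ ((n : ℝ) / (2 * s)) * (1 + q) ^ n / ((1 - q ^ 2) ^ s * q ^ n))
    (R : ℝ) (hR : 0 < R) (x : EuclideanSpace ℝ (Fin n)) (hx : ‖x‖ < R) :
    F₂ * (∫ y in Metric.ball (0 : EuclideanSpace ℝ (Fin n)) R, fracGreen n s R x y)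
      - (F₁ + F₂) *
        (∫ y in Metric.ball (0 : EuclideanSpace ℝ (Fin n)) (q * R), fracGreen n s R x y)
      < 0 := by
  obtain ⟨hs0, hs1⟩ := hs
  obtain ⟨hq0, hq1⟩ := hq
  have hX : 0 < R ^ 2 - ‖x‖ ^ 2 := by rw [sub_pos]; gcongr
  have hq2 : 0 < 1 - q ^ 2 := by nlinarith
  set C := Real.Gamma ((n : ℝ) / 2) /
    (2 ^ (2 * s) * Real.pi ^ (1 / (n : ℝ)) * Real.Gamma s ^ 2) with hC
  have hCpos : 0 < C := by
    have h1 := Real.Gamma_pos_of_pos hs0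
    have h2 : 0 < Real.Gamma ((n : ℝ) / 2) :=
      Real.Gamma_pos_of_pos (div_pos (by exact_mod_cast (by omega : 0 < n)) two_pos)
    positivity
  have hG : ∀ y, fracGreen n s R x y = C * greenProfile n s R x y := fun y => by
    rw [fracGreen, greenProfile, mul_div_assoc]
  simp_rw [hG, integral_const_mul]
  have hup := setIntegral_greenProfile_le hn hs0 hx
  have hlow := lt_setIntegral_greenProfile hn hs0 hq0 hq1 hx
  set V := volume.real (Metric.ball (0 : EuclideanSpace ℝ (Fin n)) 1)
  set I := ∫ y in Metric.ball (0 : EuclideanSpace ℝ (Fin n)) R, greenProfile n s R x y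
  set J := ∫ y in Metric.ball (0 : EuclideanSpace ℝ (Fin n)) (q * R), greenProfile n s R x y
  set K := ((n : ℝ) / (2 * s)) * (1 + q) ^ n / ((1 - q ^ 2) ^ s * q ^ n) with hK
  set L := (R ^ 2 - ‖x‖ ^ 2) ^ s * (1 - q ^ 2) ^ s * q ^ n / (s * (1 + q) ^ n) * V with hL
  have hL0 : 0 ≤ L := by positivity
  have hKL : (R ^ 2 - ‖x‖ ^ 2) ^ s / (2 * s ^ 2) * (n * V) = K * L := by
    have := Real.rpow_pos_of_pos hq2 s
    rw [hK, hL]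
    field_simp
  have hFK : K * F₂ ≤ F₁ + F₂ := (le_div_iff₀ hF₂).1 hF
  have hmain : F₂ * I < (F₁ + F₂) * J := by
    calc F₂ * I ≤ F₂ * (K * L) := by rw [← hKL]; gcongr
      _ = K * F₂ * L := by ring
      _ ≤ (F₁ + F₂) * L := by gcongr
      _ < (F₁ + F₂) * J := by gcongr
  have := mul_lt_mul_of_pos_left hmain hCpos
  linarith
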